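/- Let m ≥ 1, r ≥ 1, k ≥ 2 be integers and n = 2m. Work in the field of rational functions over ℚ in indeterminates x₁,…,x_n. Set γ = r − 1 and β = k − 2, and let μ be the weakly increasing vector of length n given by μ_{2i+1} = iβ and μ_{2i+2} = iβ + γ for i = 0, 1, …, m−1. Then ( ∏_{1≤i≤m<j≤n} (x_i^k − x_j^k)/(x_i − x_j) ) · det( (x_i^r − x_{m+j}^r)/(x_i^k − x_{m+j}^k) )_{1≤i,j≤m} = Δ(x₁,…,x_m) · Δ(x_{m+1},…,x_n) · s_μ(x₁,…,x_n). -/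

import Mathlib

open Finset

/-- The Schur polynomial for a weakly increasing index vector `μ` of length `p`,
as `det(tᵢ^{μⱼ + j - 1}) / det(tᵢ^{j-1})` (0-indexed: `det(tᵢ^{μⱼ + j}) / det(tᵢ^j)`). -/
noncomputable def schur {K : Type*} [Field K] {p : ℕ} (μ : Fin p → ℕ) (t : Fin p → K) : K :=
  Matrix.det (Matrix.of fun i j : Fin p => t i ^ (μ j + (j : ℕ))) /
    Matrix.det (Matrix.of fun i j : Fin p => t i ^ (j : ℕ))

/-- `Δ(t₁,…,t_p) = ∏_{i<j} (tᵢ - tⱼ)`. -/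
noncomputable def vanderm {K : Type*} [Field K] {p : ℕ} (t : Fin p → K) : K :=
  ∏ i : Fin p, ∏ j : Fin p, if i < j then t i - t j else 1

/-- The field of rational functions over `ℚ` in `x₁,…,x_n`. -/
abbrev RatFunc17 (n : ℕ) : Type := FractionRing (MvPolynomial (Fin n) ℚ)

noncomputable def X17 (n : ℕ) (i : Fin n) : RatFunc17 n :=
  algebraMap (MvPolynomial (Fin n) ℚ) _ (MvPolynomial.X i)

/-- The values `ℓᵢ(bⱼ)` of the Lagrange basis polynomials on the nodes `a` carry the Vandermonde
matrix of `a` to that of `b`. -/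
theorem lagrange_mul_vandermonde {K : Type*} [Field K] {m : ℕ} (a b : Fin m → K)
    (ha : Function.Injective a) :
    (Matrix.of fun j i : Fin m => ((Lagrange.basis univ a i).eval (b j))) * Matrix.vandermonde a =
      Matrix.vandermonde b := by
  ext j l
  have h := Lagrange.eq_interpolate (s := univ) (v := a)
    (f := (Polynomial.X : Polynomial K) ^ l.val) ha.injOn (by simp)
  have h2 := congrArg (Polynomial.eval (b j)) h
  rw [Lagrange.interpolate_apply, Polynomial.eval_finsetSum] at h2
  simp only [Polynomial.eval_pow, Polynomial.eval_X, Polynomial.eval_mul, Polynomial.eval_C] at h2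
  rw [Matrix.mul_apply, Matrix.vandermonde_apply, h2]
  exact sum_congr rfl fun i _ => by simp [Matrix.vandermonde_apply, mul_comm]

theorem eval_lagrange_basis_eq_div {K : Type*} [Field K] {m : ℕ} (a : Fin m → K) (y : K)
    (i : Fin m) (hy : a i ≠ y) :
    (Lagrange.basis univ a i).eval y =
      (∏ l, (a l - y)) * ((∏ l ∈ {i}ᶜ, (a l - a i))⁻¹ * (1 / (a i - y))) := by
  have hy' : a i - y ≠ 0 := sub_ne_zero.mpr hy
  rw [Lagrange.basis, Polynomial.eval_prod, ← mul_prod_erase univ _ (mem_univ i), compl_singleton,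
    ← sdiff_singleton_eq_erase, sdiff_singleton_eq_erase, ← prod_inv_distrib]
  have : ∀ l, Polynomial.eval y (Lagrange.basisDivisor (a i) (a l)) =
      (a l - y) * (a l - a i)⁻¹ := by
    intro l
    rw [Lagrange.basisDivisor, Polynomial.eval_mul, Polynomial.eval_C, Polynomial.eval_sub,
      Polynomial.eval_X, Polynomial.eval_C, ← neg_sub (a l) (a i), ← neg_sub (a l) y, inv_neg]
    ring
  simp only [this, prod_mul_distrib]
  field_simp

/-- The sign `(-1) ^ (m choose 2)`. -/
def pairSign (K : Type*) [Field K] (m : ℕ) : K := ∏ i : Fin m, ∏ _j ∈ Ioi i, (-1)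

theorem pairSign_mul_self (K : Type*) [Field K] (m : ℕ) : pairSign K m * pairSign K m = 1 := by
  simp only [pairSign, ← prod_mul_distrib, neg_mul_neg, mul_one, prod_const_one]

theorem vanderm_eq_prod_Ioi {K : Type*} [Field K] {m : ℕ} (a : Fin m → K) :
    vanderm a = ∏ i, ∏ j ∈ Ioi i, (a i - a j) := by
  refine prod_congr rfl fun i _ => ?_
  rw [← prod_filter]
  congr 1
  ext j
  simp

theorem vanderm_eq_pairSign_mul_det {K : Type*} [Field K] {m : ℕ} (a : Fin m → K) :
    vanderm a = pairSign K m * (Matrix.vandermonde a).det := by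
  rw [vanderm_eq_prod_Ioi, Matrix.det_vandermonde, pairSign]
  simp only [← prod_mul_distrib]
  simp

theorem vanderm_eq_det_vandermonde_neg {K : Type*} [Field K] {m : ℕ} (a : Fin m → K) :
    vanderm a = (Matrix.vandermonde fun i => -a i).det := by
  rw [vanderm_eq_prod_Ioi, Matrix.det_vandermonde]
  exact prod_congr rfl fun i _ => prod_congr rfl fun j _ => by ring

theorem prod_off_diag_sub {K : Type*} [Field K] {m : ℕ} (a : Fin m → K) :
    ∏ i, ∏ l ∈ {i}ᶜ, (a l - a i) = pairSign K m * (Matrix.vandermonde a).det ^ 2 := by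
  rw [← prod_prod_Ioi_mul_eq_prod_prod_off_diag (fun l i => a l - a i), Matrix.det_vandermonde,
    pairSign, sq]
  simp only [← prod_mul_distrib]
  exact prod_congr rfl fun i _ => prod_congr rfl fun j _ => by ring

/-- Cauchy's determinant, in differences. -/
theorem prod_mul_det_inv_sub {K : Type*} [Field K] {m : ℕ} (a b : Fin m → K)
    (ha : Function.Injective a) (hab : ∀ i j, a i ≠ b j) :
    (∏ i, ∏ j, (a i - b j)) * (Matrix.of fun i j : Fin m => 1 / (a i - b j)).det =
      pairSign K m * (Matrix.vandermonde a).det * (Matrix.vandermonde b).det := by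
  have hA : (Matrix.vandermonde a).det ≠ 0 := Matrix.det_vandermonde_ne_zero_iff.mpr ha
  have h := congrArg Matrix.det (lagrange_mul_vandermonde a b ha)
  simp only [eval_lagrange_basis_eq_div a _ _ (hab _ _)] at h
  have h1 := Matrix.det_mul_column (fun j => ∏ l, (a l - b j)) (Matrix.of fun j i : Fin m =>
    (∏ l ∈ {i}ᶜ, (a l - a i))⁻¹ * (1 / (a i - b j)))
  have h2 := Matrix.det_mul_row (fun i => (∏ l ∈ {i}ᶜ, (a l - a i))⁻¹)
    (Matrix.of fun i j : Fin m => 1 / (a i - b j)).transpose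
  simp only [Matrix.of_apply, Matrix.transpose_apply] at h1 h2
  rw [Matrix.det_mul, h1, h2, Matrix.det_transpose, prod_inv_distrib, prod_off_diag_sub,
    prod_comm] at h
  have hs := pairSign_mul_self K m
  have hs0 : pairSign K m ≠ 0 := left_ne_zero_of_mul_eq_one hs
  rw [← h]
  field_simp

/-- Evaluation of the block determinant with Vandermonde blocks, scaled by `u` and `v`. -/
theorem det_fromBlocks_vandermonde {K : Type*} [Field K] {m : ℕ} (a b u v : Fin m → K)
    (ha : Function.Injective a) (hab : ∀ i j, a i ≠ b j) :
    (Matrix.fromBlocks (Matrix.vandermonde a) (Matrix.diagonal u * Matrix.vandermonde a)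
      (Matrix.vandermonde b) (Matrix.diagonal v * Matrix.vandermonde b)).det =
      (-1) ^ m * pairSign K m * ((∏ i, ∏ j, (a i - b j)) *
        (Matrix.of fun i j : Fin m => (u i - v j) / (a i - b j)).det) := by
  have hA : (Matrix.vandermonde a).det ≠ 0 := Matrix.det_vandermonde_ne_zero_iff.mpr ha
  set A := Matrix.vandermonde a
  set B := Matrix.vandermonde b
  set C : Matrix (Fin m) (Fin m) K :=
    Matrix.of fun j i : Fin m => ((Lagrange.basis univ a i).eval (b j)) with hC
  have hCA : C * A = B := lagrange_mul_vandermonde a b ha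
  have h := congrArg Matrix.det (Matrix.fromBlocks_multiply 1 0 (-C) 1 A (Matrix.diagonal u * A)
    B (Matrix.diagonal v * B))
  have e1 : -C * A + 1 * B = 0 := by rw [Matrix.neg_mul, hCA, one_mul, neg_add_cancel]
  have e2 : -C * (Matrix.diagonal u * A) + 1 * (Matrix.diagonal v * B) =
      (Matrix.diagonal v * C - C * Matrix.diagonal u) * A := by
    rw [← hCA]; noncomm_ring
  have e3 : (Matrix.diagonal v * C - C * Matrix.diagonal u) = Matrix.of fun j i : Fin m =>
      (∏ l, (a l - b j)) * (-(∏ l ∈ {i}ᶜ, (a l - a i))⁻¹ * ((u i - v j) / (a i - b j))) := by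
    ext j i
    simp only [Matrix.sub_apply, Matrix.diagonal_mul, Matrix.mul_diagonal, hC, Matrix.of_apply,
      eval_lagrange_basis_eq_div a _ _ (hab _ _)]
    ring
  have h1 := Matrix.det_mul_column (fun j => ∏ l, (a l - b j)) (Matrix.of fun j i : Fin m =>
    -(∏ l ∈ {i}ᶜ, (a l - a i))⁻¹ * ((u i - v j) / (a i - b j)))
  have h2 := Matrix.det_mul_row (fun i => -(∏ l ∈ {i}ᶜ, (a l - a i))⁻¹)
    (Matrix.of fun i j : Fin m => (u i - v j) / (a i - b j)).transpose
  simp only [Matrix.of_apply, Matrix.transpose_apply] at h1 h2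
  rw [Matrix.det_mul, Matrix.det_fromBlocks_zero₁₂, e1, e2, Matrix.det_fromBlocks_zero₂₁,
    Matrix.det_one, one_mul, one_mul, one_mul, Matrix.zero_mul, add_zero, Matrix.det_mul,
    e3, h1, h2, Matrix.det_transpose, prod_neg, card_univ, Fintype.card_fin, prod_inv_distrib,
    prod_off_diag_sub, prod_comm] at h
  have hs := pairSign_mul_self K m
  have hs0 : pairSign K m ≠ 0 := left_ne_zero_of_mul_eq_one hs
  rw [h, show Matrix.vandermonde a = A from rfl]
  field_simp
  rw [sq, hs, mul_one]

/-- The concatenation of two blocks of length `m`. -/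
def concatEquiv (m : ℕ) : Fin m ⊕ Fin m ≃ Fin (2 * m) :=
  finSumFinEquiv.trans (finCongr (two_mul m).symm)

/-- The interleaving of two blocks of length `m`: the first goes to the even positions and the
second to the odd ones. -/
def interleaveEquiv (m : ℕ) : Fin m ⊕ Fin m ≃ Fin (2 * m) where
  toFun := Sum.elim (fun i => ⟨2 * i, by omega⟩) (fun i => ⟨2 * i + 1, by omega⟩)
  invFun j := if (j : ℕ) % 2 = 1 then Sum.inr ⟨j / 2, by omega⟩ else Sum.inl ⟨j / 2, by omega⟩
  left_inv := by
    rintro (i | i)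
    · simp
    · simp [Fin.ext_iff]; omega
  right_inv j := by
    by_cases h : (j : ℕ) % 2 = 1 <;> simp [h, Fin.ext_iff] <;> omega

/-- The sign of the permutation that turns concatenation into interleaving. -/
def interleaveSign (K : Type*) [Field K] (m : ℕ) : K :=
  ((Equiv.Perm.sign ((interleaveEquiv m).trans (concatEquiv m).symm) : ℤ) : K)

theorem interleaveSign_ne_zero (K : Type*) [Field K] (m : ℕ) : interleaveSign K m ≠ 0 := by
  unfold interleaveSign
  rcases Int.units_eq_one_or
    (Equiv.Perm.sign ((interleaveEquiv m).trans (concatEquiv m).symm)) with h | h <;> simp [h]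

/-- The generalized Vandermonde determinant with exponents `0, r, k, k + r, 2k, 2k + r, …`. -/
theorem interleaveSign_mul_det_pow {K : Type*} [Field K] {m : ℕ} (t : Fin (2 * m) → K) (r k : ℕ)
    (ht : Function.Injective fun i => t i ^ k) :
    interleaveSign K m * (Matrix.of fun i j : Fin (2 * m) =>
        t i ^ ((j : ℕ) / 2 * k + if (j : ℕ) % 2 = 1 then r else 0)).det =
      (-1) ^ m * pairSign K m *
        ((∏ i : Fin m, ∏ j : Fin m,
            (t (concatEquiv m (.inl i)) ^ k - t (concatEquiv m (.inr j)) ^ k)) *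
          (Matrix.of fun i j : Fin m =>
            (t (concatEquiv m (.inl i)) ^ r - t (concatEquiv m (.inr j)) ^ r) /
            (t (concatEquiv m (.inl i)) ^ k - t (concatEquiv m (.inr j)) ^ k)).det) := by
  rw [← det_fromBlocks_vandermonde (fun i : Fin m => t (concatEquiv m (.inl i)) ^ k)
    (fun j : Fin m => t (concatEquiv m (.inr j)) ^ k)
    (fun i : Fin m => t (concatEquiv m (.inl i)) ^ r)
    (fun j : Fin m => t (concatEquiv m (.inr j)) ^ r)]
  · rw [interleaveSign, ← Matrix.det_submatrix_equiv_self (concatEquiv m), ← Matrix.det_permute']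
    congr 1
    ext (i | i) (j | j) <;>
      simp [concatEquiv, interleaveEquiv, Matrix.vandermonde_apply, Fin.natAdd, Fin.castAdd,
        Fin.castLE, Fin.cast, ← pow_mul, pow_add, Nat.add_div, Matrix.diagonal_mul, mul_comm]
  · intro i j h
    simpa using ht h
  · intro i j h
    simpa using ht h

theorem prod_mul_det_eq_vanderm_mul_schur {K : Type*} [Field K] (m r k : ℕ) (hr : 1 ≤ r)
    (hk : 2 ≤ k) (t : Fin (2 * m) → K)
    (ht : ∀ k, 1 ≤ k → Function.Injective fun i => t i ^ k) :
    (∏ i : Fin m, ∏ j : Fin m,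
        (t (concatEquiv m (.inl i)) ^ k - t (concatEquiv m (.inr j)) ^ k) /
          (t (concatEquiv m (.inl i)) - t (concatEquiv m (.inr j)))) *
      Matrix.det (Matrix.of fun i j : Fin m =>
        (t (concatEquiv m (.inl i)) ^ r - t (concatEquiv m (.inr j)) ^ r) /
          (t (concatEquiv m (.inl i)) ^ k - t (concatEquiv m (.inr j)) ^ k))
      = vanderm (fun i : Fin m => t (concatEquiv m (.inl i))) *
          vanderm (fun i : Fin m => t (concatEquiv m (.inr i))) *
          schur (fun j : Fin (2 * m) =>
              ((j : ℕ) / 2) * (k - 2) + if (j : ℕ) % 2 = 1 then r - 1 else 0) t := by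
  have ht1 : Function.Injective t := by simpa using ht 1 le_rfl
  have hnum := interleaveSign_mul_det_pow t r k (ht k (by omega))
  have hden := interleaveSign_mul_det_pow t 1 2 (ht 2 (by omega))
  have hne : ∀ i j : Fin m, t (concatEquiv m (.inl i)) - t (concatEquiv m (.inr j)) ≠ 0 := by
    intro i j h
    simpa using ht1 (sub_eq_zero.mp h)
  have hne2 : ∀ i j : Fin m, t (concatEquiv m (.inl i)) + t (concatEquiv m (.inr j)) ≠ 0 := by
    intro i j h
    have := @ht 2 (by omega) (concatEquiv m (.inl i)) (concatEquiv m (.inr j))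
      (by simp only [eq_neg_of_add_eq_zero_left h, neg_sq])
    simp at this
  have hx : Function.Injective fun i : Fin m => t (concatEquiv m (.inl i)) := by
    intro i j h
    simpa using ht1 h
  have hy : Function.Injective fun i : Fin m => t (concatEquiv m (.inr i)) := by
    intro i j h
    simpa using ht1 h
  have hs := pairSign_mul_self K m
  have hs0 : pairSign K m ≠ 0 := left_ne_zero_of_mul_eq_one hs
  have hcauchy := prod_mul_det_inv_sub (fun i : Fin m => t (concatEquiv m (.inl i)))
    (fun i : Fin m => -t (concatEquiv m (.inr i))) hx
    (fun i j h => hne2 i j (by rw [h]; ring))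
  rw [← vanderm_eq_pairSign_mul_det, ← vanderm_eq_det_vandermonde_neg] at hcauchy
  have hfac : (∏ i : Fin m, ∏ j : Fin m,
        (t (concatEquiv m (.inl i)) ^ 2 - t (concatEquiv m (.inr j)) ^ 2)) *
      (Matrix.of fun i j : Fin m =>
        (t (concatEquiv m (.inl i)) ^ 1 - t (concatEquiv m (.inr j)) ^ 1) /
            (t (concatEquiv m (.inl i)) ^ 2 - t (concatEquiv m (.inr j)) ^ 2)).det =
      (∏ i : Fin m, ∏ j : Fin m, (t (concatEquiv m (.inl i)) - t (concatEquiv m (.inr j)))) *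
        (vanderm (fun i : Fin m => t (concatEquiv m (.inl i))) *
          vanderm (fun i : Fin m => t (concatEquiv m (.inr i)))) := by
    rw [← hcauchy, ← mul_assoc]
    simp only [← prod_mul_distrib]
    congr 1
    · exact prod_congr rfl fun i _ => prod_congr rfl fun j _ => by ring
    · congr 1
      ext i j
      have h1 := hne i j
      have h2 := hne2 i j
      simp only [Matrix.of_apply, pow_one, sq_sub_sq, sub_neg_eq_add]
      field_simp
  rw [hfac] at hden
  have hexp : ∀ j : ℕ, j / 2 * (k - 2) + (if j % 2 = 1 then r - 1 else 0) + j =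
      j / 2 * k + if j % 2 = 1 then r else 0 := by
    intro j
    obtain ⟨k, rfl⟩ := Nat.exists_eq_add_of_le' hk
    rw [Nat.add_sub_cancel, mul_add]
    split_ifs <;> omega
  have hexp' : ∀ j : ℕ, j / 2 * 2 + (if j % 2 = 1 then 1 else 0) = j := by
    intro j
    split_ifs <;> omega
  simp only [hexp'] at hden
  have hX : vanderm (fun i : Fin m => t (concatEquiv m (.inl i))) ≠ 0 := by
    rw [vanderm_eq_pairSign_mul_det]
    exact mul_ne_zero hs0 (Matrix.det_vandermonde_ne_zero_iff.mpr hx)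
  have hY : vanderm (fun i : Fin m => t (concatEquiv m (.inr i))) ≠ 0 := by
    rw [vanderm_eq_pairSign_mul_det]
    exact mul_ne_zero hs0 (Matrix.det_vandermonde_ne_zero_iff.mpr hy)
  have hQ : (∏ i : Fin m, ∏ j : Fin m, (t (concatEquiv m (.inl i)) - t (concatEquiv m (.inr j)))) ≠
      0 :=
    prod_ne_zero_iff.mpr fun i _ => prod_ne_zero_iff.mpr fun j _ => hne i j
  have hε := interleaveSign_ne_zero K m
  have hu : (-1 : K) ^ m ≠ 0 := pow_ne_zero _ (by simp)
  simp only [schur, hexp, prod_div_distrib]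
  rw [← mul_div_mul_left (Matrix.det _) _ hε, hnum, hden]
  field_simp

theorem X17_pow_injective (n k : ℕ) (hk : 1 ≤ k) : Function.Injective fun i => X17 n i ^ k := by
  intro i j h
  simp only [X17, ← map_pow] at h
  have hmon := IsFractionRing.injective (MvPolynomial (Fin n) ℚ) (RatFunc17 n) h
  rw [MvPolynomial.X_pow_eq_monomial, MvPolynomial.X_pow_eq_monomial] at hmon
  exact (Finsupp.single_left_inj (by omega)).mp (MvPolynomial.monomial_left_injective one_ne_zero hmon)

/-- With `γ = r - 1`, `β = k - 2`, and `μ = [0, γ, β, β+γ, 2β, 2β+γ, …, (m-1)β, (m-1)β+γ]`: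
`∏_{1≤i≤m<j≤n} (xᵢᵏ-xⱼᵏ)/(xᵢ-xⱼ) · det( (xᵢʳ-x_{m+j}ʳ)/(xᵢᵏ-x_{m+j}ᵏ) )_{1≤i,j≤m}
  = Δ(x₁,…,x_m)·Δ(x_{m+1},…,x_n)·s_μ(x₁,…,x_n)`. -/
theorem det_powers_eq_schur (m r k : ℕ) (hm : 1 ≤ m) (hr : 1 ≤ r) (hk : 2 ≤ k) :
    (∏ i : Fin m, ∏ j : Fin m,
        (X17 (2 * m) ⟨i.val, by omega⟩ ^ k - X17 (2 * m) ⟨m + j.val, by omega⟩ ^ k) /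
          (X17 (2 * m) ⟨i.val, by omega⟩ - X17 (2 * m) ⟨m + j.val, by omega⟩)) *
      Matrix.det (Matrix.of fun i j : Fin m =>
        (X17 (2 * m) ⟨i.val, by omega⟩ ^ r - X17 (2 * m) ⟨m + j.val, by omega⟩ ^ r) /
          (X17 (2 * m) ⟨i.val, by omega⟩ ^ k - X17 (2 * m) ⟨m + j.val, by omega⟩ ^ k))
      = vanderm (fun i : Fin m => X17 (2 * m) ⟨i.val, by omega⟩) *
          vanderm (fun i : Fin m => X17 (2 * m) ⟨m + i.val, by omega⟩) *
          schur (fun j : Fin (2 * m) =>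
              ((j : ℕ) / 2) * (k - 2) + if (j : ℕ) % 2 = 1 then r - 1 else 0)
            (X17 (2 * m)) := by
  exact prod_mul_det_eq_vanderm_mul_schur m r k hr hk _ (X17_pow_injective (2 * m))
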